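/- (V-representation subdifferential) Let V be an n×m real matrix such that 0 lies in the interior of C_V(V). For every x ∈ ℝⁿ, the subdifferential of ψ_V at x satisfies ∂ψ_V(x) = {h ∈ ℝⁿ : hᵀx = ψ_V(x) and hᵀV ≤ 1ᵀ componentwise}. -/

import Mathlib

open Matrix Pointwise

/-- The V-representation polyhedron `C_V(V)`: the convex hull of the columns of `V`,
`{x : x = Vp, p ≥ 0, 1ᵀp = 1}`. -/
def polyV {n m : ℕ} (V : Matrix (Fin n) (Fin m) ℝ) : Set (Fin n → ℝ) :=
  {x | ∃ p : Fin m → ℝ, (∀ i, 0 ≤ p i) ∧ (∑ i, p i) = 1 ∧ x = V.mulVec p}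

/-- The gauge function `ψ_V(x) = inf {1ᵀp : x = Vp, p ≥ 0}`. -/
noncomputable def psiV {n m : ℕ} (V : Matrix (Fin n) (Fin m) ℝ) (x : Fin n → ℝ) : ℝ :=
  sInf {r : ℝ | ∃ p : Fin m → ℝ, (∀ i, 0 ≤ p i) ∧ x = V.mulVec p ∧ (∑ i, p i) = r}

/-- The subdifferential `∂ψ_V(x) = {h : ψ_V(y) − ψ_V(x) ≥ hᵀ(y − x) for all y}`. -/
def subdiffV {n m : ℕ} (V : Matrix (Fin n) (Fin m) ℝ) (x : Fin n → ℝ) : Set (Fin n → ℝ) :=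
  {h | ∀ y : Fin n → ℝ, psiV V y - psiV V x ≥ h ⬝ᵥ (y - x)}

lemma exists_nonneg_mulVec_eq {n m : ℕ} {V : Matrix (Fin n) (Fin m) ℝ}
    (hV : (0 : Fin n → ℝ) ∈ interior (polyV V)) (x : Fin n → ℝ) :
    ∃ p : Fin m → ℝ, (∀ i, 0 ≤ p i) ∧ x = V.mulVec p := by
  have hlim : Filter.Tendsto (fun t : ℝ => t • x) (nhds 0) (nhds 0) := by
    have hcont : Continuous fun t : ℝ => t • x := by fun_prop
    simpa using hcont.tendsto 0
  have hev : ∀ᶠ t : ℝ in nhdsWithin 0 (Set.Ioi 0), t • x ∈ polyV V :=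
    (hlim.eventually (mem_interior_iff_mem_nhds.mp hV)).filter_mono nhdsWithin_le_nhds
  obtain ⟨t, ⟨p, hp, -, hx⟩, ht⟩ := (hev.and self_mem_nhdsWithin).exists
  have ht : 0 < t := ht
  refine ⟨t⁻¹ • p, fun i => mul_nonneg (inv_nonneg.mpr ht.le) (hp i), ?_⟩
  rw [Matrix.mulVec_smul, ← hx, inv_smul_smul₀ ht.ne']

lemma psiV_mulVec_le_sum {n m : ℕ} (V : Matrix (Fin n) (Fin m) ℝ) {p : Fin m → ℝ}
    (hp : ∀ i, 0 ≤ p i) : psiV V (V.mulVec p) ≤ ∑ i, p i := by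
  refine csInf_le ⟨0, ?_⟩ ⟨p, hp, rfl, rfl⟩
  rintro r ⟨q, hq, -, rfl⟩
  exact Finset.sum_nonneg fun i _ => hq i

lemma le_psiV {n m : ℕ} {V : Matrix (Fin n) (Fin m) ℝ}
    (hV : (0 : Fin n → ℝ) ∈ interior (polyV V)) {x : Fin n → ℝ} {c : ℝ}
    (hc : ∀ p : Fin m → ℝ, (∀ i, 0 ≤ p i) → x = V.mulVec p → c ≤ ∑ i, p i) :
    c ≤ psiV V x := by
  obtain ⟨p, hp, hx⟩ := exists_nonneg_mulVec_eq hV x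
  refine le_csInf ⟨_, p, hp, hx, rfl⟩ ?_
  rintro r ⟨q, hq, hxq, rfl⟩
  exact hc q hq hxq

lemma psiV_add_le {n m : ℕ} {V : Matrix (Fin n) (Fin m) ℝ}
    (hV : (0 : Fin n → ℝ) ∈ interior (polyV V)) (x y : Fin n → ℝ) :
    psiV V (x + y) ≤ psiV V x + psiV V y := by
  rw [← sub_le_iff_le_add]
  refine le_psiV hV fun p hp hx => ?_
  rw [sub_le_comm]
  refine le_psiV hV fun q hq hy => ?_
  rw [sub_le_iff_le_add', hx, hy, ← Matrix.mulVec_add, ← Finset.sum_add_distrib]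
  exact psiV_mulVec_le_sum V fun i => add_nonneg (hp i) (hq i)

lemma psiV_zero_le {n m : ℕ} (V : Matrix (Fin n) (Fin m) ℝ) : psiV V 0 ≤ 0 := by
  simpa using psiV_mulVec_le_sum V (p := 0) fun _ => le_rfl

lemma psiV_col_le_one {n m : ℕ} (V : Matrix (Fin n) (Fin m) ℝ) (j : Fin m) :
    psiV V (Vᵀ j) ≤ 1 := by
  have hj : ∀ i, 0 ≤ (Pi.single j 1 : Fin m → ℝ) i :=
    fun i => (Pi.single_nonneg.mpr zero_le_one : (0 : Fin m → ℝ) ≤ Pi.single j 1) i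
  have h := psiV_mulVec_le_sum V hj
  rw [Matrix.mulVec_single_one, Finset.sum_pi_single'] at h
  simpa [Matrix.col] using h

lemma dotProduct_le_psiV {n m : ℕ} {V : Matrix (Fin n) (Fin m) ℝ}
    (hV : (0 : Fin n → ℝ) ∈ interior (polyV V)) {h : Fin n → ℝ}
    (hh : ∀ j, h ⬝ᵥ Vᵀ j ≤ 1) (y : Fin n → ℝ) : h ⬝ᵥ y ≤ psiV V y := by
  refine le_psiV hV ?_
  rintro p hp rfl
  rw [Matrix.dotProduct_mulVec]
  exact Finset.sum_le_sum fun j _ => mul_le_of_le_one_left (hp j) (hh j)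

theorem stmt6 {n m : ℕ} (V : Matrix (Fin n) (Fin m) ℝ)
    (hV : (0 : Fin n → ℝ) ∈ interior (polyV V)) (x : Fin n → ℝ) :
    subdiffV V x = {h : Fin n → ℝ | h ⬝ᵥ x = psiV V x ∧ ∀ j, h ⬝ᵥ Vᵀ j ≤ 1} := by
  ext h
  constructor
  · intro hh
    refine ⟨le_antisymm ?_ ?_, fun j => ?_⟩
    · have h_double := hh (x + x)
      rw [add_sub_cancel_right] at h_double
      linarith [psiV_add_le hV x x]
    · have h_zero := hh 0
      rw [zero_sub, dotProduct_neg] at h_zero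
      linarith [psiV_zero_le V]
    · have h_col := hh (x + Vᵀ j)
      rw [add_sub_cancel_left] at h_col
      linarith [psiV_add_le hV x (Vᵀ j), psiV_col_le_one V j]
  · rintro ⟨hx, hcol⟩ y
    rw [dotProduct_sub, hx]
    exact sub_le_sub_right (dotProduct_le_psiV hV hcol y) _
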